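/- Let p, q, a, b be positive integers with 2 ≤ a ≤ b, and let T_{a,b} denote the infinite bi-regular tree. Maker has a winning strategy in the (p,q)-percolation game on T_{a,b} if and only if p(b−2) − ⌈p/a⌉(b−a) ≥ q, irrespective of the choice of the root. -/

import Mathlib

/-! ### Core definitions for the `(p,q)`-percolation game

Two players, Maker and Breaker, play in alternating turns on an infinite connected
graph `G` with root `v₀`, Maker playing first.  On each of her turns Maker marks `p`
as-yet-unclaimed edges as safe, while on each of his turns Breaker deletes `q`
as-yet-unclaimed edges.  Breaker wins if at some time the connected component of `v₀`
(in `G` with Breaker's edges deleted) is finite; Maker wins if she can keep it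
infinite forever. -/

namespace PercGame

/-- A positional strategy: given the sets of edges claimed so far by Maker and by
Breaker, produce the finite set of edges to claim next. -/
abbrev Strategy (V : Type) : Type := Finset (Sym2 V) → Finset (Sym2 V) → Finset (Sym2 V)

variable {V : Type} [DecidableEq V]

/-- Maker legally claims exactly `p` as-yet-unclaimed edges of `G` on each turn. -/
def MakerLegal (G : SimpleGraph V) (p : ℕ) (σ : Strategy V) : Prop :=
  ∀ M B : Finset (Sym2 V),
    (σ M B).card = p ∧ ↑(σ M B) ⊆ G.edgeSet ∧ Disjoint (σ M B) (M ∪ B)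

/-- Breaker legally deletes exactly `q` as-yet-unclaimed edges of `G` on each turn. -/
def BreakerLegal (G : SimpleGraph V) (q : ℕ) (τ : Strategy V) : Prop :=
  ∀ M B : Finset (Sym2 V),
    (τ M B).card = q ∧ ↑(τ M B) ⊆ G.edgeSet ∧ Disjoint (τ M B) (M ∪ B)

/-- The position (Maker's safe edges, Breaker's deleted edges) after `n` full rounds of
play starting from the position `init`; Maker moves first in every round. -/
def play (σ τ : Strategy V) (init : Finset (Sym2 V) × Finset (Sym2 V)) :
    ℕ → Finset (Sym2 V) × Finset (Sym2 V)
  | 0 => init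
  | n + 1 =>
    let P := play σ τ init n
    let M := P.1 ∪ σ P.1 P.2
    (M, P.2 ∪ τ M P.2)

/-- The vertex set of the connected component of `v₀` in `G` after deleting the edges
in `B`. -/
def comp (G : SimpleGraph V) (v₀ : V) (B : Finset (Sym2 V)) : Set V :=
  {w : V | (G.deleteEdges (↑B : Set (Sym2 V))).Reachable v₀ w}

/-- Maker has a winning strategy in the `(p,q)`-percolation game on `(G, v₀)`:
she can ensure that `v₀` lies in an infinite component at all times. -/
def MakerWins (G : SimpleGraph V) (v₀ : V) (p q : ℕ) : Prop :=
  ∃ σ : Strategy V, MakerLegal G p σ ∧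
    ∀ τ : Strategy V, BreakerLegal G q τ →
      ∀ n : ℕ, (comp G v₀ (play σ τ (∅, ∅) n).2).Infinite

/-- Breaker has a winning strategy in the `(p,q)`-percolation game on `(G, v₀)`:
he can ensure that at some time the component of `v₀` becomes finite. -/
def BreakerWins (G : SimpleGraph V) (v₀ : V) (p q : ℕ) : Prop :=
  ∃ τ : Strategy V, BreakerLegal G q τ ∧
    ∀ σ : Strategy V, MakerLegal G p σ →
      ∃ n : ℕ, (comp G v₀ (play σ τ (∅, ∅) n).2).Finite

end PercGame

namespace PercGame

/-- A rooting at `v₀` of a tree whose vertices have degree `a` in `S` and `b` outside `S`. -/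
structure Rooting {V : Type} (T : SimpleGraph V) (v₀ : V) (S : Set V) (a b : ℕ) where
  par : V → V
  kids : V → Finset V
  mem_kids : ∀ {v w}, w ∈ kids v ↔ w ≠ v₀ ∧ par w = v
  adj_par : ∀ {v}, v ≠ v₀ → T.Adj v (par v)
  of_adj : ∀ {u w}, T.Adj u w → (u ≠ v₀ ∧ par u = w) ∨ (w ≠ v₀ ∧ par w = u)
  dist_par_lt : ∀ {v}, v ≠ v₀ → T.dist v₀ (par v) < T.dist v₀ v
  two_le_card_kids_root : 2 ≤ (kids v₀).card
  card_kids_of_mem : ∀ {v}, v ≠ v₀ → v ∈ S → (kids v).card + 1 = a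
  card_kids_of_notMem : ∀ {v}, v ≠ v₀ → v ∉ S → (kids v).card + 1 = b
  mem_iff_of_mem_kids : ∀ {v w}, w ∈ kids v → (w ∈ S ↔ v ∉ S)

theorem exists_adj_dist_lt {V : Type} {T : SimpleGraph V} (hconn : T.Connected) (v₀ v : V)
    (hv : v ≠ v₀) : ∃ w, T.Adj v w ∧ T.dist v₀ w < T.dist v₀ v := by
  obtain ⟨p, hp⟩ := (hconn.preconnected v v₀).exists_walk_length_eq_dist
  cases p with
  | nil => exact absurd rfl hv
  | cons h p =>
    refine ⟨_, h, ?_⟩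
    rw [T.dist_comm (u := v₀), T.dist_comm (u := v₀), ← hp, SimpleGraph.Walk.length_cons]
    exact Nat.lt_succ_of_le (SimpleGraph.dist_le p)

theorem Rooting.nonempty {V : Type} {T : SimpleGraph V} {S : Set V} {a b : ℕ} (ha : 2 ≤ a)
    (hb : 2 ≤ b) (hconn : T.Connected) (hacyc : T.IsAcyclic)
    (hI : ∀ v ∈ S, T.neighborSet v ⊆ Sᶜ ∧ (T.neighborSet v).ncard = a)
    (hII : ∀ v ∉ S, T.neighborSet v ⊆ S ∧ (T.neighborSet v).ncard = b) (v₀ : V) :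
    Nonempty (Rooting T v₀ S a b) := by
  classical
  choose! par hadj hlt using exists_adj_dist_lt hconn v₀
  have hof : ∀ {u w}, T.Adj u w → (u ≠ v₀ ∧ par u = w) ∨ (w ≠ v₀ ∧ par w = u) := by
    intro u w huw
    by_contra! hcon
    have hbr := (SimpleGraph.isAcyclic_iff_forall_adj_isBridge.1 hacyc) huw
    rw [SimpleGraph.isBridge_iff] at hbr
    have hreach : ∀ n v, T.dist v₀ v = n →
        (T \ SimpleGraph.fromEdgeSet {s(u, w)}).Reachable v v₀ := by
      intro n
      induction n using Nat.strong_induction_on with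
      | _ n ih =>
        intro v hn
        by_cases hv : v = v₀
        · rw [hv]
        · refine SimpleGraph.Reachable.trans (SimpleGraph.Adj.reachable ?_)
            (ih _ (hn ▸ hlt v hv) (par v) rfl)
          rw [SimpleGraph.sdiff_adj]
          refine ⟨hadj v hv, fun h => ?_⟩
          rw [SimpleGraph.fromEdgeSet_adj, Set.mem_singleton_iff, Sym2.eq_iff] at h
          rcases h.1 with ⟨h1, h2⟩ | ⟨h1, h2⟩
          · exact hcon.1 (h1 ▸ hv) (h1 ▸ h2)
          · exact hcon.2 (h1 ▸ hv) (h1 ▸ h2)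
    exact hbr ((hreach _ u rfl).trans (hreach _ w rfl).symm)
  have hfin : ∀ v, (T.neighborSet v).Finite := by
    intro v
    apply Set.finite_of_ncard_ne_zero
    by_cases hv : v ∈ S
    · rw [(hI v hv).2]; omega
    · rw [(hII v hv).2]; omega
  have hsub : ∀ v, {w | w ≠ v₀ ∧ par w = v} ⊆ T.neighborSet v := by
    rintro v w ⟨hw, rfl⟩
    exact (hadj w hw).symm
  have hkf : ∀ v, {w | w ≠ v₀ ∧ par w = v}.Finite := fun v => (hfin v).subset (hsub v)
  have hroot : ((hkf v₀).toFinset).card = (T.neighborSet v₀).ncard := by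
    rw [← Set.ncard_eq_toFinset_card _ (hkf v₀)]
    congr 1
    refine (hsub v₀).antisymm fun w hw => ?_
    rcases hof hw with h | h
    · exact absurd rfl h.1
    · exact h
  have hcard : ∀ v, v ≠ v₀ → ((hkf v).toFinset).card + 1 = (T.neighborSet v).ncard := by
    intro v hv
    rw [← Set.ncard_eq_toFinset_card _ (hkf v), ← Set.ncard_insert_of_notMem (a := par v) _ (hkf v)]
    · congr 1
      ext w
      constructor
      · rintro (rfl | h)
        · exact hadj v hv
        · exact hsub v h
      · intro h
        rcases hof h with h | h
        · exact Or.inl h.2.symm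
        · exact Or.inr h
    · rintro ⟨h1, h2⟩
      have h3 := hlt _ h1
      have h4 := hlt _ hv
      rw [h2] at h3
      omega
  refine ⟨⟨par, fun v => (hkf v).toFinset, by simp, @hadj, hof, @hlt, ?_, ?_, ?_, ?_⟩⟩
  · rw [hroot]
    by_cases hv : v₀ ∈ S
    · rwa [(hI _ hv).2]
    · rwa [(hII _ hv).2]
  · intro v hv hS
    rw [hcard v hv, (hI v hS).2]
  · intro v hv hS
    rw [hcard v hv, (hII v hS).2]
  · intro v w hw
    have hw' := hsub v ((hkf v).mem_toFinset.1 hw)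
    by_cases hv : v ∈ S
    · simpa [hv] using (hI v hv).1 hw'
    · simpa [hv] using (hII v hv).1 hw'

namespace Rooting

variable {V : Type} {T : SimpleGraph V} {v₀ : V} {S : Set V} {a b : ℕ} (R : Rooting T v₀ S a b)

/-- The edge joining a vertex to its parent. -/
def edge (v : V) : Sym2 V := s(v, R.par v)

theorem edge_mem {v : V} (hv : v ≠ v₀) : R.edge v ∈ T.edgeSet := R.adj_par hv

theorem exists_edge_eq {e : Sym2 V} (he : e ∈ T.edgeSet) : ∃ v ≠ v₀, R.edge v = e := by
  induction e with
  | _ u w =>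
    rcases R.of_adj he with ⟨h, h'⟩ | ⟨h, h'⟩
    · exact ⟨u, h, by rw [edge, h']⟩
    · exact ⟨w, h, by rw [edge, h', Sym2.eq_swap]⟩

theorem edge_inj {v w : V} (hv : v ≠ v₀) (hw : w ≠ v₀) (h : R.edge v = R.edge w) : v = w := by
  rcases Sym2.eq_iff.1 h with h | ⟨h1, h2⟩
  · exact h.1
  · have h3 := R.dist_par_lt hv
    have h4 := R.dist_par_lt hw
    rw [h2] at h3
    rw [← h1] at h4
    omega

theorem edgeSet_infinite (R : Rooting T v₀ S a b) [Infinite V] : T.edgeSet.Infinite := by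
  have h : (R.edge '' {v₀}ᶜ).Infinite :=
    (Set.finite_singleton v₀).infinite_compl.image fun v hv w hw h => R.edge_inj hv hw h
  exact h.mono (by rintro _ ⟨v, hv, rfl⟩; exact R.edge_mem hv)

theorem exists_fresh (R : Rooting T v₀ S a b) [Infinite V] (X : Finset (Sym2 V)) (n : ℕ) :
    ∃ E : Finset (Sym2 V), E.card = n ∧ ↑E ⊆ T.edgeSet ∧ Disjoint E X := by
  obtain ⟨E, hE, hn⟩ := (R.edgeSet_infinite.sdiff X.finite_toSet).exists_subset_card_eq n
  refine ⟨E, hn, fun e he => (hE he).1, Finset.disjoint_left.2 fun e he => (hE he).2⟩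

/-- A vertex is alive if no edge on its path to the root has been deleted. -/
inductive Alive (B : Finset (Sym2 V)) : V → Prop
  | root : Alive B v₀
  | step {v : V} : v ≠ v₀ → Alive B (R.par v) → R.edge v ∉ B → Alive B v

variable {R}

theorem Alive.inv {B : Finset (Sym2 V)} {v : V} (h : R.Alive B v) (hv : v ≠ v₀) :
    R.Alive B (R.par v) ∧ R.edge v ∉ B := by
  cases h with
  | root => exact absurd rfl hv
  | step _ h h' => exact ⟨h, h'⟩

theorem Alive.anti {B B' : Finset (Sym2 V)} (hB : B ⊆ B') {v : V} (h : R.Alive B' v) :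
    R.Alive B v := by
  induction h with
  | root => exact .root
  | step hv _ he ih => exact .step hv ih fun h => he (hB h)

variable (R)

theorem mem_comp [DecidableEq V] {B : Finset (Sym2 V)} {v : V} : v ∈ comp T v₀ B ↔ R.Alive B v := by
  constructor
  · rintro ⟨p⟩
    have key : ∀ {x y : V}, (T.deleteEdges (↑B : Set (Sym2 V))).Walk x y →
        R.Alive B x → R.Alive B y := by
      intro x y p
      induction p with
      | nil => exact id
      | cons h p ih =>
        refine fun hx => ih ?_
        rw [SimpleGraph.deleteEdges_adj] at h
        rcases R.of_adj h.1 with ⟨h1, rfl⟩ | ⟨h1, rfl⟩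
        · exact (hx.inv h1).1
        · exact .step h1 hx (by rw [edge, Sym2.eq_swap]; exact h.2)
    exact key p .root
  · intro h
    induction h with
    | root => exact SimpleGraph.Reachable.refl _
    | step hv _ he ih =>
      refine SimpleGraph.Reachable.trans ih (SimpleGraph.Adj.reachable ?_)
      rw [SimpleGraph.deleteEdges_adj]
      exact ⟨(R.adj_par hv).symm, by rw [Sym2.eq_swap]; exact he⟩

/-- A finite set of vertices that contains the root and is closed under taking parents. -/
def IsRooted (K : Finset V) : Prop := v₀ ∈ K ∧ ∀ v ∈ K, v ≠ v₀ → R.par v ∈ K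

/-- Maker's safe edges are exactly those joining the vertices of the rooted set `K`. -/
structure IsCluster (K : Finset V) (M : Finset (Sym2 V)) : Prop where
  rooted : R.IsRooted K
  edge_mem_iff : ∀ v, v ≠ v₀ → (R.edge v ∈ M ↔ v ∈ K)

theorem isCluster_singleton : R.IsCluster {v₀} ∅ where
  rooted := ⟨by simp, fun v hv hv₀ => absurd (Finset.mem_singleton.1 hv) hv₀⟩
  edge_mem_iff v hv := by simp [hv]

variable {R} [DecidableEq V]

theorem IsRooted.insert {K : Finset V} (hK : R.IsRooted K) {w : V} (hw : R.par w ∈ K) :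
    R.IsRooted (insert w K) := by
  refine ⟨Finset.mem_insert_of_mem hK.1, fun v hv hv₀ => ?_⟩
  rcases Finset.mem_insert.1 hv with rfl | hv
  · exact Finset.mem_insert_of_mem hw
  · exact Finset.mem_insert_of_mem (hK.2 v hv hv₀)

variable (R)

/-- The vertices outside `K` whose parent lies in `K`. -/
def bdry (K : Finset V) : Finset V := K.biUnion R.kids \ K

theorem mem_bdry {K : Finset V} {w : V} :
    w ∈ R.bdry K ↔ w ≠ v₀ ∧ R.par w ∈ K ∧ w ∉ K := by
  simp only [bdry, Finset.mem_sdiff, Finset.mem_biUnion, R.mem_kids]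
  constructor
  · rintro ⟨⟨v, hv, h, rfl⟩, h'⟩
    exact ⟨h, hv, h'⟩
  · rintro ⟨h, hv, h'⟩
    exact ⟨⟨_, hv, h, rfl⟩, h'⟩

/-! ### Maker's strategy -/

variable {R}

theorem IsCluster.insert {K : Finset V} {M : Finset (Sym2 V)} (h : R.IsCluster K M) {w : V}
    (hw : w ∈ R.bdry K) : R.IsCluster (insert w K) (insert (R.edge w) M) := by
  rw [mem_bdry] at hw
  refine ⟨h.rooted.insert hw.2.1, fun v hv => ?_⟩
  rw [Finset.mem_insert, Finset.mem_insert, h.edge_mem_iff v hv]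
  exact or_congr_left ⟨R.edge_inj hv hw.1, fun h => h ▸ rfl⟩

theorem notMem_of_mem_kids_bdry {K : Finset V} (hK : R.IsRooted K) {w z : V}
    (hw : w ∈ R.bdry K) (hz : z ∈ R.kids w) : z ∉ insert w K := by
  rw [mem_bdry] at hw
  obtain ⟨hz₀, rfl⟩ := R.mem_kids.1 hz
  intro h
  rcases Finset.mem_insert.1 h with h | h
  · have := R.dist_par_lt hz₀
    rw [← h] at this
    exact lt_irrefl _ this
  · exact hw.2.2 (hK.2 _ h hz₀)

theorem kids_subset_bdry_insert {K : Finset V} (hK : R.IsRooted K) {w : V}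
    (hw : w ∈ R.bdry K) : R.kids w ⊆ R.bdry (insert w K) := by
  intro z hz
  have h := R.mem_kids.1 hz
  exact R.mem_bdry.2 ⟨h.1, by simp [h.2], notMem_of_mem_kids_bdry hK hw hz⟩

theorem erase_bdry_subset_bdry_insert {K : Finset V} {w : V} :
    (R.bdry K).erase w ⊆ R.bdry (insert w K) := by
  intro z hz
  rw [Finset.mem_erase, mem_bdry] at hz
  rw [mem_bdry, Finset.mem_insert, Finset.mem_insert]
  tauto

theorem card_bdry_insert {K : Finset V} (hK : R.IsRooted K) {w : V} (hw : w ∈ R.bdry K) :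
    (R.bdry K).card + (R.kids w).card ≤ (R.bdry (insert w K)).card + 1 := by
  have hd : Disjoint ((R.bdry K).erase w) (R.kids w) := by
    refine Finset.disjoint_left.2 fun z hz hz' => ?_
    rw [Finset.mem_erase, mem_bdry] at hz
    rw [R.mem_kids] at hz'
    rw [mem_bdry] at hw
    exact hw.2.2 (hz'.2 ▸ hz.2.2.1)
  have h := Finset.card_le_card (Finset.union_subset
    (erase_bdry_subset_bdry_insert (R := R) (K := K) (w := w)) (kids_subset_bdry_insert hK hw))
  rw [Finset.card_union_of_disjoint hd, Finset.card_erase_of_mem hw] at h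
  omega

/-- Each deleted edge spoils at most one boundary vertex of `K`. -/
theorem exists_clean_bdry {K : Finset V} {B : Finset (Sym2 V)}
    (hlt : B.card < (R.bdry K).card) :
    ∃ w ∈ R.bdry K, R.edge w ∉ B ∧ ∀ z ∈ R.kids w, R.edge z ∉ B := by
  by_contra! hcon
  have h : ∀ w ∈ R.bdry K, ∃ z, z ≠ v₀ ∧ R.edge z ∈ B ∧ (z = w ∨ R.par z = w) := by
    intro w hw
    by_cases hwB : R.edge w ∈ B
    · exact ⟨w, (R.mem_bdry.1 hw).1, hwB, .inl rfl⟩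
    · obtain ⟨z, hz, hzB⟩ := hcon w hw hwB
      exact ⟨z, (R.mem_kids.1 hz).1, hzB, .inr (R.mem_kids.1 hz).2⟩
  choose! f hf₀ hfB hf using h
  refine absurd (Finset.card_le_card_of_injOn (fun w => R.edge (f w)) hfB ?_) (not_le.2 hlt)
  intro w hw w' hw' heq
  have hff := R.edge_inj (hf₀ w hw) (hf₀ w' hw') heq
  have h1 := R.mem_bdry.1 hw
  have h2 := R.mem_bdry.1 hw'
  rcases hf w hw with h | h <;> rcases hf w' hw' with h' | h'
  · rw [← h, ← h', hff]
  · rw [← hff, h] at h'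
    exact absurd (h' ▸ h1.2.1) h2.2.2
  · rw [hff, h'] at h
    exact absurd (h ▸ h2.2.1) h1.2.2
  · rw [← h, ← h', hff]

/-- The outcome of `t` greedy picks by Maker, `i` of which lead to a vertex of `S`; the set `F`
consists of boundary vertices outside `S` that are still available. -/
theorem IsCluster.exists_extension (ha : 2 ≤ a) (hab : a ≤ b) {K : Finset V}
    {M B : Finset (Sym2 V)} (hK : R.IsCluster K M) (hlt : B.card < (R.bdry K).card) (t : ℕ) :
    ∃ (K' : Finset V) (E : Finset (Sym2 V)) (F : Finset V) (i j : ℕ), E.card = t ∧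
      ↑E ⊆ T.edgeSet ∧ Disjoint E (M ∪ B) ∧ R.IsCluster K' (M ∪ E) ∧ i + j = t ∧
      (R.bdry K).card + i * (a - 2) + j * (b - 2) ≤ (R.bdry K').card ∧
      F ⊆ R.bdry K' ∧ (∀ w ∈ F, w ∉ S ∧ R.edge w ∉ B) ∧ F.card + 1 ≤ a ∧
      a * i ≤ t + F.card := by
  induction t with
  | zero => exact ⟨K, ∅, ∅, 0, 0, by simpa using ⟨hK, by omega⟩⟩
  | succ t ih =>
    obtain ⟨K', E, F, i, j, hEt, hET, hEd, hK', hij, hcard, hF, hFS, hFa, hai⟩ := ih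
    have hlt' : B.card < (R.bdry K').card := by omega
    suffices hstep : ∃ w ∈ R.bdry K', R.edge w ∉ B ∧ ∃ F' : Finset V,
        F' ⊆ R.bdry (Insert.insert w K') ∧ (∀ w ∈ F', w ∉ S ∧ R.edge w ∉ B) ∧ F'.card + 1 ≤ a ∧
        (w ∈ S → a * (i + 1) ≤ t + 1 + F'.card) ∧ (w ∉ S → a * i ≤ t + 1 + F'.card) by
      obtain ⟨w, hw, hwB, F', hF', hFS', hFa', h1, h2⟩ := hstep
      have hw' := R.mem_bdry.1 hw
      have hwM : R.edge w ∉ M ∪ E := fun h => hw'.2.2 ((hK'.edge_mem_iff w hw'.1).1 h)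
      have hEd' : Disjoint (Insert.insert (R.edge w) E) (M ∪ B) := by
        rw [Finset.disjoint_insert_left]
        exact ⟨fun h => (Finset.mem_union.1 h).elim
          (fun h => hwM (Finset.mem_union_left _ h)) hwB, hEd⟩
      have hET' : ↑(Insert.insert (R.edge w) E) ⊆ T.edgeSet := by
        rw [Finset.coe_insert]
        exact Set.insert_subset (R.edge_mem hw'.1) hET
      have hEt' : (Insert.insert (R.edge w) E).card = t + 1 := by
        rw [Finset.card_insert_of_notMem fun h => hwM (Finset.mem_union_right _ h), hEt]
      have hc := card_bdry_insert hK'.rooted hw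
      have hK'' := hK'.insert hw
      rw [← Finset.union_insert] at hK''
      by_cases hwS : w ∈ S
      · have hk := R.card_kids_of_mem hw'.1 hwS
        refine ⟨_, _, F', i + 1, j, hEt', hET', hEd', hK'', by omega, ?_, hF', hFS', hFa', h1 hwS⟩
        rw [add_one_mul]
        omega
      · have hk := R.card_kids_of_notMem hw'.1 hwS
        refine ⟨_, _, F', i, j + 1, hEt', hET', hEd', hK'', by omega, ?_, hF', hFS', hFa', h2 hwS⟩
        rw [add_one_mul]
        omega
    rcases F.eq_empty_or_nonempty with rfl | ⟨w, hw⟩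
    · obtain ⟨w, hw, hwB, hclean⟩ := exists_clean_bdry hlt'
      rw [Finset.card_empty] at hai
      by_cases hwS : w ∈ S
      · have hk := R.card_kids_of_mem (R.mem_bdry.1 hw).1 hwS
        refine ⟨w, hw, hwB, R.kids w, kids_subset_bdry_insert hK'.rooted hw, fun z hz =>
          ⟨fun h => (R.mem_iff_of_mem_kids hz).1 h hwS, hclean z hz⟩, by omega, fun _ => ?_,
          fun h => absurd hwS h⟩
        rw [mul_add_one]
        omega
      · exact ⟨w, hw, hwB, ∅, by simp, by simp, hFa, fun h => absurd h hwS, fun _ => by omega⟩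
    · have hc := Finset.card_erase_add_one hw
      exact ⟨w, hF hw, (hFS w hw).2, F.erase w,
        (Finset.erase_subset_erase _ hF).trans erase_bdry_subset_bdry_insert,
        fun z hz => hFS z (Finset.mem_of_mem_erase hz), by omega,
        fun h => absurd h (hFS w hw).1, fun _ => by omega⟩

theorem IsCluster.comp_infinite (ha : 2 ≤ a) (hab : a ≤ b) {K : Finset V}
    {M B : Finset (Sym2 V)} (hK : R.IsCluster K M) (hMB : Disjoint M B)
    (hlt : B.card < (R.bdry K).card) : (comp T v₀ B).Infinite := by
  intro hfin
  obtain ⟨K', E, -, -, -, hEt, hET, hEd, hK', -⟩ :=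
    hK.exists_extension ha hab hlt (hfin.toFinset.card + 1)
  have halive : ∀ n v, T.dist v₀ v = n → v ∈ K' → R.Alive B v := by
    intro n
    induction n using Nat.strong_induction_on with
    | _ n ih =>
      intro v hn hv
      by_cases hv₀ : v = v₀
      · rw [hv₀]; exact .root
      · refine .step hv₀ (ih _ (hn ▸ R.dist_par_lt hv₀) _ rfl (hK'.rooted.2 v hv hv₀)) ?_
        have h := (hK'.edge_mem_iff v hv₀).2 hv
        rcases Finset.mem_union.1 h with h | h
        · exact Finset.disjoint_left.1 hMB h
        · exact fun h' => Finset.disjoint_left.1 hEd h (Finset.mem_union_right _ h')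
  have h1 : E ⊆ K'.image R.edge := by
    intro e he
    obtain ⟨v, hv, rfl⟩ := R.exists_edge_eq (hET he)
    exact Finset.mem_image_of_mem _ ((hK'.edge_mem_iff v hv).1 (Finset.mem_union_right _ he))
  have h2 : K' ⊆ hfin.toFinset := by
    intro v hv
    rw [Set.Finite.mem_toFinset, R.mem_comp]
    exact halive _ v rfl hv
  have := (Finset.card_le_card h1).trans Finset.card_image_le
  have := Finset.card_le_card h2
  omega

theorem IsCluster.exists_move (ha : 2 ≤ a) (hab : a ≤ b) {p q : ℕ}
    (hq : (q : ℤ) ≤ (p : ℤ) * ((b : ℤ) - 2) -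
      (((p + a - 1) / a : ℕ) : ℤ) * ((b : ℤ) - (a : ℤ))) {K : Finset V}
    {M B : Finset (Sym2 V)} (hK : R.IsCluster K M) (hlt : B.card < (R.bdry K).card) :
    ∃ (K' : Finset V) (E : Finset (Sym2 V)), E.card = p ∧ ↑E ⊆ T.edgeSet ∧ Disjoint E (M ∪ B) ∧
      R.IsCluster K' (M ∪ E) ∧ B.card + q < (R.bdry K').card := by
  obtain ⟨K', E, F, i, j, hEt, hET, hEd, hK', hij, hcard, -, -, hFa, hai⟩ :=
    hK.exists_extension ha hab hlt p
  refine ⟨K', E, hEt, hET, hEd, hK', ?_⟩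
  have hi : i ≤ (p + a - 1) / a := by
    rw [Nat.le_div_iff_mul_le (by omega), mul_comm]
    omega
  generalize (p + a - 1) / a = c at hq hi
  zify [ha, ha.trans hab] at hcard hi hij hlt ⊢
  have hab' : (a : ℤ) ≤ b := by exact_mod_cast hab
  nlinarith [mul_nonneg (sub_nonneg.2 hi) (sub_nonneg.2 hab')]

variable (R)

theorem two_le_card_bdry_singleton : 2 ≤ (R.bdry {v₀}).card := by
  refine R.two_le_card_kids_root.trans (Finset.card_le_card fun w hw => ?_)
  have h := R.mem_kids.1 hw
  rw [mem_bdry]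
  simp [h.1, h.2]

theorem makerWins (R : Rooting T v₀ S a b) [Infinite V] (ha : 2 ≤ a) (hab : a ≤ b) {p q : ℕ}
    (hq : (q : ℤ) ≤ (p : ℤ) * ((b : ℤ) - 2) -
      (((p + a - 1) / a : ℕ) : ℤ) * ((b : ℤ) - (a : ℤ))) : MakerWins T v₀ p q := by
  have hmove : ∀ M B : Finset (Sym2 V), ∃ E : Finset (Sym2 V),
      (E.card = p ∧ ↑E ⊆ T.edgeSet ∧ Disjoint E (M ∪ B)) ∧
      ∀ K, R.IsCluster K M → B.card < (R.bdry K).card →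
        ∃ K', R.IsCluster K' (M ∪ E) ∧ B.card + q < (R.bdry K').card := by
    intro M B
    by_cases h : ∃ K, R.IsCluster K M ∧ B.card < (R.bdry K).card
    · obtain ⟨K, hK, hlt⟩ := h
      obtain ⟨K', E, h1, h2, h3, hK', hlt'⟩ := hK.exists_move ha hab hq hlt
      exact ⟨E, ⟨h1, h2, h3⟩, fun _ _ _ => ⟨K', hK', hlt'⟩⟩
    · obtain ⟨E, hE⟩ := R.exists_fresh (M ∪ B) p
      exact ⟨E, hE, fun K hK hlt => absurd ⟨K, hK, hlt⟩ h⟩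
  choose σ hσ hσK using hmove
  refine ⟨σ, hσ, fun τ hτ n => ?_⟩
  have hinv : Disjoint (play σ τ (∅, ∅) n).1 (play σ τ (∅, ∅) n).2 ∧
      ∃ K, R.IsCluster K (play σ τ (∅, ∅) n).1 ∧
        (play σ τ (∅, ∅) n).2.card < (R.bdry K).card := by
    induction n with
    | zero =>
      refine ⟨Finset.disjoint_empty_left _, {v₀}, R.isCluster_singleton, ?_⟩
      have := R.two_le_card_bdry_singleton
      simp only [play, Finset.card_empty]
      omega
    | succ n ih =>
      simp only [play]
      generalize play σ τ (∅, ∅) n = P at ih ⊢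
      obtain ⟨hd, K, hK, hlt⟩ := ih
      obtain ⟨K', hK', hlt'⟩ := hσK P.1 P.2 K hK hlt
      obtain ⟨hcτ, -, hdτ⟩ := hτ (P.1 ∪ σ P.1 P.2) P.2
      refine ⟨?_, K', hK', ?_⟩
      · rw [Finset.disjoint_union_right]
        refine ⟨Finset.disjoint_union_left.2 ⟨hd, ?_⟩, ?_⟩
        · exact Finset.disjoint_of_subset_right Finset.subset_union_right (hσ P.1 P.2).2.2
        · exact (Finset.disjoint_of_subset_right Finset.subset_union_left hdτ).symm
      · have := Finset.card_union_le P.2 (τ (P.1 ∪ σ P.1 P.2) P.2)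
        omega
  obtain ⟨hd, K, hK, hlt⟩ := hinv
  exact hK.comp_infinite ha hab hd hlt

/-! ### Breaker's strategy -/

/-- The vertices of `X`, other than the root, whose edge to the parent is not safe. -/
def unclaimed (M : Finset (Sym2 V)) (X : Finset V) : Finset V :=
  (X.erase v₀).filter fun v => R.edge v ∉ M

/-- `K` is a virtual cluster for Maker: she has claimed enough edges to pay for the part of any
rooted set that lies outside `K`. -/
structure IsGuard (M B : Finset (Sym2 V)) (K : Finset V) : Prop where
  rooted : R.IsRooted K
  alive : ∀ v ∈ K, R.Alive B v
  balanced : ∀ X, R.IsRooted X → (∀ v ∈ X, R.Alive B v) →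
    (X \ K).card ≤ (R.unclaimed M X).card

/-- The boundary vertices of `K` whose edge to `K` has not been deleted. -/
def frontier (B : Finset (Sym2 V)) (K : Finset V) : Finset V :=
  (R.bdry K).filter fun v => R.edge v ∉ B

open Classical in
/-- The part of the frontier outside `S`. -/
noncomputable def outer (B : Finset (Sym2 V)) (K : Finset V) : Finset V :=
  (R.frontier B K).filter fun v => v ∉ S

theorem mem_frontier {B : Finset (Sym2 V)} {K : Finset V} {w : V} :
    w ∈ R.frontier B K ↔ w ≠ v₀ ∧ R.par w ∈ K ∧ w ∉ K ∧ R.edge w ∉ B := by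
  rw [frontier, Finset.mem_filter, mem_bdry]
  tauto

theorem mem_outer {B : Finset (Sym2 V)} {K : Finset V} {w : V} :
    w ∈ R.outer B K ↔ w ∈ R.frontier B K ∧ w ∉ S := by
  classical
  unfold outer
  exact Finset.mem_filter

variable {R}

theorem Alive.exists_path {B : Finset (Sym2 V)} {w : V} (h : R.Alive B w) :
    ∃ X : Finset V, R.IsRooted X ∧ w ∈ X ∧ (∀ x ∈ X, R.Alive B x) ∧
      ∀ B', R.Alive B' w → ∀ x ∈ X, x ≠ v₀ → R.edge x ∉ B' := by
  induction h with
  | root =>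
    refine ⟨{v₀}, R.isCluster_singleton.rooted, by simp, ?_, ?_⟩
    · simp only [Finset.mem_singleton, forall_eq]
      exact .root
    · simp
  | @step v hv hp he ih =>
    obtain ⟨X, hX, hpX, hXB, hXB'⟩ := ih
    refine ⟨Insert.insert v X, hX.insert hpX, Finset.mem_insert_self _ _, ?_, ?_⟩
    · exact (Finset.forall_mem_insert _ _ _).2 ⟨.step hv hp he, hXB⟩
    · intro B' hB'
      exact (Finset.forall_mem_insert _ _ _).2
        ⟨fun _ => (hB'.inv hv).2, hXB' B' (hB'.inv hv).1⟩

theorem card_unclaimed_le (M : Finset (Sym2 V)) (z : V) (hz : z ≠ v₀) (X : Finset V) :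
    (R.unclaimed M X).card ≤ (R.unclaimed (insert (R.edge z) M) X).card + 1 := by
  refine (Finset.card_le_card (t := Insert.insert z (R.unclaimed (insert (R.edge z) M) X))
    fun v hv => ?_).trans (Finset.card_insert_le _ _)
  simp only [unclaimed, Finset.mem_filter, Finset.mem_erase, Finset.mem_insert] at hv ⊢
  by_cases hvz : v = z
  · exact .inl hvz
  · exact .inr ⟨hv.1, not_or.2 ⟨fun h => hvz (R.edge_inj hv.1.1 hz h), hv.2⟩⟩

theorem card_unclaimed_union_add_inter (M : Finset (Sym2 V)) (X Y : Finset V) :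
    (R.unclaimed M (X ∪ Y)).card + (R.unclaimed M (X ∩ Y)).card =
      (R.unclaimed M X).card + (R.unclaimed M Y).card := by
  rw [← Finset.card_union_add_card_inter (R.unclaimed M X)]
  congr 2 <;> ext v <;>
    simp only [unclaimed, Finset.mem_filter, Finset.mem_erase, Finset.mem_union,
      Finset.mem_inter] <;> tauto

theorem card_union_sdiff_add_inter (K X Y : Finset V) :
    ((X ∪ Y) \ K).card + ((X ∩ Y) \ K).card = (X \ K).card + (Y \ K).card := by
  rw [← Finset.card_union_add_card_inter (X \ K), ← Finset.union_sdiff_distrib]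
  congr 2
  ext v
  simp only [Finset.mem_sdiff, Finset.mem_inter]
  tauto

/-- After Maker claims one edge, the virtual cluster grows by at most one frontier vertex. -/
theorem IsGuard.insert_safe {M B : Finset (Sym2 V)} {K : Finset V} (h : R.IsGuard M B K)
    {z : V} (hz : z ≠ v₀) :
    ∃ K', R.IsGuard (insert (R.edge z) M) B K' ∧
      (K' = K ∨ ∃ v ∈ R.frontier B K, K' = insert v K) := by
  set M' := Insert.insert (R.edge z) M
  have hlow : ∀ X, R.IsRooted X → (∀ v ∈ X, R.Alive B v) →
      (X \ K).card ≤ (R.unclaimed M' X).card + 1 := fun X hX hXB =>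
    (h.balanced X hX hXB).trans (card_unclaimed_le M z hz X)
  by_cases hbal : ∀ X, R.IsRooted X → (∀ v ∈ X, R.Alive B v) →
      (X \ K).card ≤ (R.unclaimed M' X).card
  · exact ⟨K, ⟨h.rooted, h.alive, hbal⟩, .inl rfl⟩
  let P : ℕ → Prop := fun n => ∃ X : Finset V, X.card = n ∧ R.IsRooted X ∧
    (∀ v ∈ X, R.Alive B v) ∧ (R.unclaimed M' X).card < (X \ K).card
  have hP : ∃ n, P n := by
    push Not at hbal
    obtain ⟨X, hX⟩ := hbal
    exact ⟨_, X, rfl, hX⟩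
  classical
  obtain ⟨X₀, hX₀n, hX₀, hX₀B, hX₀lt⟩ := Nat.find_spec hP
  have hne : (X₀ \ K).Nonempty := Finset.card_pos.1 (by omega)
  obtain ⟨v, hv, hvmin⟩ := (X₀ \ K).exists_min_image (T.dist v₀) hne
  rw [Finset.mem_sdiff] at hv
  have hv₀ : v ≠ v₀ := fun hv' => hv.2 (hv' ▸ h.rooted.1)
  have hpar : R.par v ∈ K := by
    by_contra hpar
    exact absurd (hvmin _ (Finset.mem_sdiff.2 ⟨hX₀.2 v hv.1 hv₀, hpar⟩))
      (not_le.2 (R.dist_par_lt hv₀))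
  refine ⟨Insert.insert v K, ⟨h.rooted.insert hpar, ?_, fun X hX hXB => ?_⟩, .inr ⟨v, ?_, rfl⟩⟩
  · exact (Finset.forall_mem_insert _ _ _).2 ⟨hX₀B v hv.1, h.alive⟩
  · have hl := hlow X hX hXB
    by_cases hvX : v ∈ X
    · rw [Finset.sdiff_insert, Finset.card_erase_of_mem (Finset.mem_sdiff.2 ⟨hvX, hv.2⟩)]
      omega
    · rw [Finset.sdiff_insert_of_notMem hvX]
      by_contra! hlt
      have hinter : ((X ∩ X₀) \ K).card ≤ (R.unclaimed M' (X ∩ X₀)).card := by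
        by_contra! hlt'
        have hlt'' : (X ∩ X₀).card < Nat.find hP := by
          rw [← hX₀n]
          refine Finset.card_lt_card ⟨Finset.inter_subset_right, fun hsub => ?_⟩
          exact hvX (Finset.mem_inter.1 (hsub hv.1)).1
        refine Nat.find_min hP hlt'' ⟨X ∩ X₀, rfl, ⟨Finset.mem_inter.2 ⟨hX.1, hX₀.1⟩, ?_⟩, ?_,
          hlt'⟩
        · intro x hx hx₀
          rw [Finset.mem_inter] at hx ⊢
          exact ⟨hX.2 x hx.1 hx₀, hX₀.2 x hx.2 hx₀⟩
        · exact fun x hx => hXB x (Finset.mem_inter.1 hx).1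
      have hunion := hlow (X ∪ X₀) ⟨Finset.mem_union_left _ hX.1, fun x hx hx₀ => by
          rw [Finset.mem_union] at hx ⊢
          exact hx.imp (fun hx => hX.2 x hx hx₀) (fun hx => hX₀.2 x hx hx₀)⟩
        (fun x hx => (Finset.mem_union.1 hx).elim (hXB x) (hX₀B x))
      have h1 := card_unclaimed_union_add_inter (R := R) M' X X₀
      have h2 := card_union_sdiff_add_inter K X X₀
      omega
  · exact R.mem_frontier.2 ⟨hv₀, hpar, hv.2, ((hX₀B v hv.1).inv hv₀).2⟩

theorem frontier_insert_subset {B : Finset (Sym2 V)} {K : Finset V} {v : V} :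
    R.frontier B (insert v K) ⊆ (R.frontier B K).erase v ∪ R.kids v := by
  intro x hx
  rw [mem_frontier, Finset.mem_insert, Finset.mem_insert] at hx
  rw [Finset.mem_union, Finset.mem_erase, mem_frontier, R.mem_kids]
  tauto

theorem card_frontier_insert {B : Finset (Sym2 V)} {K : Finset V} {v : V}
    (hv : v ∈ R.frontier B K) :
    (R.frontier B (insert v K)).card + 1 ≤ (R.frontier B K).card + (R.kids v).card := by
  have h := (Finset.card_le_card (frontier_insert_subset (R := R) (B := B) (K := K)
    (v := v))).trans (Finset.card_union_le _ _)
  rw [← Finset.card_erase_add_one hv]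
  omega

theorem card_outer_insert_of_mem {B : Finset (Sym2 V)} {K : Finset V} {v : V} :
    (R.outer B (insert v K)).card ≤ (R.outer B K).card + (R.kids v).card := by
  refine (Finset.card_le_card fun x hx => ?_).trans (Finset.card_union_le _ _)
  rw [mem_outer] at hx
  rw [Finset.mem_union, mem_outer]
  have h := frontier_insert_subset hx.1
  rw [Finset.mem_union, Finset.mem_erase] at h
  tauto

theorem card_outer_insert_of_notMem {B : Finset (Sym2 V)} {K : Finset V} {v : V}
    (hv : v ∈ R.frontier B K) (hvS : v ∉ S) :
    (R.outer B (insert v K)).card + 1 ≤ (R.outer B K).card := by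
  rw [← Finset.card_erase_add_one (R.mem_outer.2 ⟨hv, hvS⟩)]
  gcongr
  intro x hx
  rw [mem_outer] at hx
  rw [Finset.mem_erase, mem_outer]
  have h := frontier_insert_subset hx.1
  rw [Finset.mem_union, Finset.mem_erase] at h
  rcases h with h | h
  · exact ⟨h.1, h.2, hx.2⟩
  · exact absurd ((R.mem_iff_of_mem_kids h).2 hvS) hx.2

theorem IsGuard.union_safe (ha : 2 ≤ a) {M B : Finset (Sym2 V)} {K : Finset V}
    (h : R.IsGuard M B K) (E : Finset (Sym2 V)) (hE : ↑E ⊆ T.edgeSet) :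
    ∃ (K' : Finset V) (x y : ℕ), R.IsGuard (M ∪ E) B K' ∧ x + y = E.card ∧
      (R.frontier B K').card ≤ (R.frontier B K).card + x * (a - 2) + y * (b - 2) ∧
      (R.outer B K').card + y ≤ (R.outer B K).card + x * (a - 1) := by
  induction E using Finset.induction_on with
  | empty => exact ⟨K, 0, 0, by simpa using h⟩
  | insert e E he ih =>
    rw [Finset.coe_insert, Set.insert_subset_iff] at hE
    obtain ⟨K₁, x, y, hK₁, hxy, hf, ho⟩ := ih hE.2
    obtain ⟨z, hz, rfl⟩ := R.exists_edge_eq hE.1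
    obtain ⟨K₂, hK₂, hor⟩ := hK₁.insert_safe hz
    rw [← Finset.union_insert] at hK₂
    have hc := Finset.card_insert_of_notMem he
    rcases hor with rfl | ⟨v, hv, rfl⟩
    · refine ⟨K₂, x + 1, y, hK₂, by omega, ?_, ?_⟩ <;> rw [add_one_mul] <;> omega
    · have h1 := card_frontier_insert hv
      have hv₀ := (R.mem_frontier.1 hv).1
      by_cases hvS : v ∈ S
      · have hk := R.card_kids_of_mem hv₀ hvS
        have h2 := card_outer_insert_of_mem (R := R) (B := B) (K := K₁) (v := v)
        refine ⟨_, x + 1, y, hK₂, by omega, ?_, ?_⟩ <;> rw [add_one_mul] <;> omega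
      · have hk := R.card_kids_of_notMem hv₀ hvS
        have h2 := card_outer_insert_of_notMem hv hvS
        refine ⟨_, x, y + 1, hK₂, by omega, ?_, by omega⟩
        rw [add_one_mul]
        omega

/-- Breaker can cut off any frontier vertex of the virtual cluster, possibly by deleting an edge
closer to the root. -/
theorem IsGuard.exists_cut {M B : Finset (Sym2 V)} {K : Finset V} (h : R.IsGuard M B K) {w : V}
    (hw : w ∈ R.frontier B K) :
    ∃ e ∈ T.edgeSet, e ∉ M ∪ B ∧ ∃ K', R.IsGuard M (insert e B) K' ∧
      R.frontier (insert e B) K' ⊆ (R.frontier B K).erase w := by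
  classical
  rw [mem_frontier] at hw
  have hwB : R.Alive B w := .step hw.1 (h.alive _ hw.2.1) hw.2.2.2
  obtain ⟨X, hX, hwX, hXB, hcut⟩ := hwB.exists_path
  have hpos : 0 < (R.unclaimed M X).card := lt_of_lt_of_le
    (Finset.card_pos.2 ⟨w, Finset.mem_sdiff.2 ⟨hwX, hw.2.2.1⟩⟩) (h.balanced X hX hXB)
  obtain ⟨x, hx⟩ := Finset.card_pos.1 hpos
  rw [unclaimed, Finset.mem_filter, Finset.mem_erase] at hx
  obtain ⟨⟨hx₀, hxX⟩, hxM⟩ := hx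
  have hsub := Finset.subset_insert (R.edge x) B
  refine ⟨R.edge x, R.edge_mem hx₀, ?_, K.filter (R.Alive (insert (R.edge x) B)), ⟨?_, ?_, ?_⟩, ?_⟩
  · rw [Finset.mem_union]
    exact not_or.2 ⟨hxM, hcut B hwB x hxX hx₀⟩
  · refine ⟨Finset.mem_filter.2 ⟨h.rooted.1, .root⟩, fun v hv hv₀ => ?_⟩
    rw [Finset.mem_filter] at hv ⊢
    exact ⟨h.rooted.2 v hv.1 hv₀, (hv.2.inv hv₀).1⟩
  · exact fun v hv => (Finset.mem_filter.1 hv).2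
  · intro Y hY hYB
    refine le_trans (Finset.card_le_card fun v hv => ?_)
      (h.balanced Y hY fun v hv => (hYB v hv).anti hsub)
    rw [Finset.mem_sdiff, Finset.mem_filter] at hv
    exact Finset.mem_sdiff.2 ⟨hv.1, fun hvK => hv.2 ⟨hvK, hYB v hv.1⟩⟩
  · intro v hv
    rw [mem_frontier, Finset.mem_filter, Finset.mem_filter] at hv
    obtain ⟨hv₀, ⟨hpK, hpB⟩, hvK, hvB⟩ := hv
    have hvalive : R.Alive (Insert.insert (R.edge x) B) v := .step hv₀ hpB hvB
    rw [Finset.mem_erase, mem_frontier]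
    refine ⟨?_, hv₀, hpK, fun h => hvK ⟨h, hvalive⟩, fun h => hvB (hsub h)⟩
    rintro rfl
    exact hcut _ hvalive x hxX hx₀ (Finset.mem_insert_self _ _)

theorem IsGuard.comp_finite {M B : Finset (Sym2 V)} {K : Finset V} (h : R.IsGuard M B K)
    (hK : R.frontier B K = ∅) : (comp T v₀ B).Finite := by
  refine K.finite_toSet.subset fun v hv => ?_
  rw [R.mem_comp] at hv
  induction hv with
  | root => exact h.rooted.1
  | @step v hv _ he ih =>
    by_contra hvK
    exact Finset.notMem_empty v (hK ▸ R.mem_frontier.2 ⟨hv, ih, hvK, he⟩)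

theorem comp_finite_mono (R : Rooting T v₀ S a b) {B B' : Finset (Sym2 V)} (hB : B ⊆ B')
    (h : (comp T v₀ B).Finite) : (comp T v₀ B').Finite := by
  refine h.subset fun v hv => ?_
  rw [R.mem_comp] at hv ⊢
  exact hv.anti hB

theorem IsGuard.exists_cuts [Infinite V] {M B : Finset (Sym2 V)} {K : Finset V}
    (h : R.IsGuard M B K) (q : ℕ) :
    ∃ E : Finset (Sym2 V), (E.card = q ∧ ↑E ⊆ T.edgeSet ∧ Disjoint E (M ∪ B)) ∧
      ((comp T v₀ (B ∪ E)).Finite ∨ ∃ K', R.IsGuard M (B ∪ E) K' ∧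
        (R.frontier (B ∪ E) K').card + q ≤ (R.frontier B K).card ∧
        (R.outer (B ∪ E) K').card ≤ (R.outer B K).card - q) := by
  induction q generalizing B K with
  | zero => exact ⟨∅, by simp, .inr ⟨K, by simpa using h⟩⟩
  | succ q ih =>
    rcases (R.frontier B K).eq_empty_or_nonempty with hemp | hne
    · obtain ⟨E, hE⟩ := R.exists_fresh (M ∪ B) (q + 1)
      exact ⟨E, hE, .inl (comp_finite_mono R Finset.subset_union_left (h.comp_finite hemp))⟩
    · obtain ⟨w, hw, hwo⟩ : ∃ w ∈ R.frontier B K, (R.outer B K).Nonempty → w ∈ R.outer B K := by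
        rcases (R.outer B K).eq_empty_or_nonempty with ho | ⟨w, hw⟩
        · exact ⟨_, hne.choose_spec, fun h => absurd ho h.ne_empty⟩
        · exact ⟨w, (R.mem_outer.1 hw).1, fun _ => hw⟩
      obtain ⟨e, heT, heMB, K₁, hK₁, hsub⟩ := h.exists_cut hw
      obtain ⟨E, ⟨hEq, hET, hEd⟩, hor⟩ := ih hK₁
      have hcf := Finset.card_le_card hsub
      have hce := Finset.card_erase_add_one hw
      have hosub : R.outer (insert e B) K₁ ⊆ (R.outer B K).erase w := by
        intro x hx
        rw [mem_outer] at hx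
        have hx' := hsub hx.1
        rw [Finset.mem_erase] at hx' ⊢
        exact ⟨hx'.1, R.mem_outer.2 ⟨hx'.2, hx.2⟩⟩
      have hco : (R.outer (insert e B) K₁).card ≤ (R.outer B K).card - 1 := by
        refine (Finset.card_le_card hosub).trans ?_
        rcases (R.outer B K).eq_empty_or_nonempty with ho | ho
        · simp [ho]
        · rw [Finset.card_erase_of_mem (hwo ho)]
      rw [Finset.union_insert, Finset.disjoint_insert_right] at hEd
      refine ⟨insert e E, ⟨?_, ?_, ?_⟩, ?_⟩
      · rw [Finset.card_insert_of_notMem hEd.1, hEq]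
      · rw [Finset.coe_insert]
        exact Set.insert_subset heT hET
      · exact Finset.disjoint_insert_left.2 ⟨heMB, hEd.2⟩
      · rw [Finset.union_insert, ← Finset.insert_union]
        refine hor.imp id ?_
        rintro ⟨K₂, hK₂, h1, h2⟩
        exact ⟨K₂, hK₂, by omega, by omega⟩

variable (R)

/-- Breaker's potential: an upper bound for the number of rounds until he wins. -/
noncomputable def potential (B : Finset (Sym2 V)) (K : Finset V) : ℕ :=
  (R.frontier B K).card + (b - a) * (((R.outer B K).card + a - 1) / a)

theorem ceil_bound {a b p q x y D D' D'' F F' F'' : ℕ} (ha : 2 ≤ a) (hab : a ≤ b) (hp : 1 ≤ p)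
    (hq : (p : ℤ) * ((b : ℤ) - 2) -
      (((p + a - 1) / a : ℕ) : ℤ) * ((b : ℤ) - (a : ℤ)) < (q : ℤ))
    (hxy : x + y = p) (hD' : D' ≤ D + x * (a - 2) + y * (b - 2)) (hF' : F' + y ≤ F + x * (a - 1))
    (hD'' : D'' + q ≤ D') (hF'' : F'' ≤ F' - q) :
    D'' + (b - a) * ((F'' + a - 1) / a) + 1 ≤ D + (b - a) * ((F + a - 1) / a) := by
  have hc : a * ((p + a - 1) / a) ≤ p + a - 1 := Nat.mul_div_le _ _
  have hcp : (p + a - 1) / a ≤ p := by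
    rw [Nat.div_le_iff_le_mul (by omega)]
    have := Nat.le_mul_of_pos_right p (by omega : 0 < a)
    omega
  have hx1 : x * (a - 1) + x = a * x := by
    obtain ⟨a, rfl⟩ : ∃ k, a = k + 1 := ⟨a - 1, by omega⟩
    simp; ring
  have hqa : a - 1 ≤ q := by
    generalize (p + a - 1) / a = c at hq hcp
    zify [(by omega : 1 ≤ a)]
    zify at hp hcp hab ha
    nlinarith [mul_nonneg (sub_nonneg.2 hcp) (sub_nonneg.2 hab),
      mul_nonneg (sub_nonneg.2 hp) (sub_nonneg.2 ha)]
  have hkey : (p + a - 1) / a + (F'' + a - 1) / a ≤ x + (F + a - 1) / a := by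
    have h1 : x + (F + a - 1) / a = (F + a * x + a - 1) / a := by
      rw [show F + a * x + a - 1 = F + a - 1 + a * x by omega,
        Nat.add_mul_div_left _ _ (by omega : 0 < a), add_comm]
    rcases Nat.eq_zero_or_pos F'' with h0 | h0
    · have : (F'' + a - 1) / a = 0 := by rw [Nat.div_eq_zero_iff]; omega
      rw [this, h1]
      exact Nat.div_le_div_right (by omega)
    · have h2 : (p + a - 1) / a + (F'' + a - 1) / a =
          (F'' + a * ((p + a - 1) / a) + a - 1) / a := by
        rw [show F'' + a * ((p + a - 1) / a) + a - 1 = F'' + a - 1 + a * ((p + a - 1) / a) by omega,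
          Nat.add_mul_div_left _ _ (by omega : 0 < a), add_comm]
      rw [h1, h2]
      exact Nat.div_le_div_right (by omega)
  generalize (p + a - 1) / a = c at *
  generalize (F'' + a - 1) / a = c'' at *
  generalize (F + a - 1) / a = c' at *
  subst hxy
  have hmul := Nat.mul_le_mul_left (b - a) hkey
  zify [ha, hab, ha.trans hab] at hD' hD'' hmul ⊢
  push_cast at hq
  linarith

/-- Breaker wins within `n` rounds. -/
def Doomed (n : ℕ) (M B : Finset (Sym2 V)) : Prop :=
  (comp T v₀ B).Finite ∨ ∃ K, R.IsGuard M B K ∧ R.potential B K ≤ n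

variable {R}

theorem Doomed.mono {m n : ℕ} (hmn : m ≤ n) {M B : Finset (Sym2 V)} (h : R.Doomed m M B) :
    R.Doomed n M B :=
  h.imp id fun ⟨K, hK, hKm⟩ => ⟨K, hK, hKm.trans hmn⟩

theorem Doomed.comp_finite {M B : Finset (Sym2 V)} (h : R.Doomed 0 M B) :
    (comp T v₀ B).Finite := by
  rcases h with h | ⟨K, hK, h0⟩
  · exact h
  · rw [potential] at h0
    exact hK.comp_finite (Finset.card_eq_zero.1 (by omega))

theorem Doomed.exists_move [Infinite V] (ha : 2 ≤ a) (hab : a ≤ b) {p q : ℕ} (hp : 1 ≤ p)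
    (hq : (p : ℤ) * ((b : ℤ) - 2) -
      (((p + a - 1) / a : ℕ) : ℤ) * ((b : ℤ) - (a : ℤ)) < (q : ℤ)) {n : ℕ}
    {M B : Finset (Sym2 V)} (h : R.Doomed (n + 1) M B) {E : Finset (Sym2 V)} (hEp : E.card = p)
    (hE : ↑E ⊆ T.edgeSet) :
    ∃ E' : Finset (Sym2 V), (E'.card = q ∧ ↑E' ⊆ T.edgeSet ∧ Disjoint E' (M ∪ E ∪ B)) ∧
      R.Doomed n (M ∪ E) (B ∪ E') := by
  rcases h with h | ⟨K, hK, hKn⟩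
  · obtain ⟨E', hE'⟩ := R.exists_fresh (M ∪ E ∪ B) q
    exact ⟨E', hE', .inl (comp_finite_mono R Finset.subset_union_left h)⟩
  · obtain ⟨K₁, x, y, hK₁, hxy, hf, ho⟩ := hK.union_safe ha E hE
    obtain ⟨E', hE', h'⟩ := hK₁.exists_cuts q
    refine ⟨E', hE', h'.imp id ?_⟩
    rintro ⟨K₂, hK₂, hf', ho'⟩
    have := ceil_bound ha hab hp hq (hxy.trans hEp) hf ho hf' ho'
    rw [potential] at hKn
    exact ⟨K₂, hK₂, by rw [potential]; omega⟩

theorem isGuard_singleton (R : Rooting T v₀ S a b) : R.IsGuard ∅ ∅ {v₀} where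
  rooted := R.isCluster_singleton.rooted
  alive v hv := by
    rw [Finset.mem_singleton.1 hv]
    exact .root
  balanced X _ _ := by simp [unclaimed, Finset.sdiff_singleton_eq_erase]

theorem breakerWins (R : Rooting T v₀ S a b) [Infinite V] (ha : 2 ≤ a) (hab : a ≤ b) {p q : ℕ}
    (hp : 1 ≤ p) (hq : (p : ℤ) * ((b : ℤ) - 2) -
      (((p + a - 1) / a : ℕ) : ℤ) * ((b : ℤ) - (a : ℤ)) < (q : ℤ)) : BreakerWins T v₀ p q := by
  have hmove : ∀ M B : Finset (Sym2 V), ∃ E : Finset (Sym2 V),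
      (E.card = q ∧ ↑E ⊆ T.edgeSet ∧ Disjoint E (M ∪ B)) ∧
      ∀ n E', (E'.card = q ∧ ↑E' ⊆ T.edgeSet ∧ Disjoint E' (M ∪ B)) →
        R.Doomed n M (B ∪ E') → R.Doomed n M (B ∪ E) := by
    intro M B
    classical
    by_cases h : ∃ (n : ℕ) (E : Finset (Sym2 V)),
        (E.card = q ∧ ↑E ⊆ T.edgeSet ∧ Disjoint E (M ∪ B)) ∧ R.Doomed n M (B ∪ E)
    · obtain ⟨E, hE, hEn⟩ := Nat.find_spec h
      exact ⟨E, hE, fun n E' hE' hn => hEn.mono (Nat.find_min' h ⟨E', hE', hn⟩)⟩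
    · obtain ⟨E, hE⟩ := R.exists_fresh (M ∪ B) q
      exact ⟨E, hE, fun n E' hE' hn => absurd ⟨n, E', hE', hn⟩ h⟩
  choose τ hτ hτn using hmove
  refine ⟨τ, hτ, fun σ hσ => ?_⟩
  have hinv : ∀ n m, R.potential ∅ {v₀} = n + m →
      R.Doomed n (play σ τ (∅, ∅) m).1 (play σ τ (∅, ∅) m).2 := by
    intro n m
    induction m generalizing n with
    | zero => exact fun h => .inr ⟨{v₀}, R.isGuard_singleton, h.le⟩
    | succ m ih =>
      intro h
      have hd := ih (n + 1) (by omega)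
      simp only [play]
      obtain ⟨E', hE', hd'⟩ := hd.exists_move ha hab hp hq (hσ _ _).1 (hσ _ _).2.1
      exact hτn _ _ n E' hE' hd'
  exact ⟨_, (hinv 0 _ (zero_add _).symm).comp_finite⟩

end Rooting

end PercGame

/-- **Theorem (percolation game on the infinite bi-regular tree `T_{a,b}`).**
Let `p, q, a, b` be positive integers with `2 ≤ a ≤ b` and let `T` be an infinite
bi-regular tree `T_{a,b}`: an infinite connected acyclic graph whose vertices come in
two types (`S` is the set of Type I vertices), with every Type I vertex adjacent to
exactly `a` Type II vertices and every Type II vertex adjacent to exactly `b` Type I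
vertices.  Maker has a winning strategy in the `(p,q)`-percolation game on `T` if and
only if `p(b-2) - ⌈p/a⌉(b-a) ≥ q`, irrespective of the choice of the root `v₀`. -/
theorem maker_wins_iff_on_biregular_tree (a b p q : ℕ) (ha : 2 ≤ a) (hab : a ≤ b)
    (hp : 1 ≤ p) (hq : 1 ≤ q)
    {V : Type} [DecidableEq V] (T : SimpleGraph V) [Infinite V]
    (hconn : T.Connected) (hacyc : T.IsAcyclic) (S : Set V)
    (hI : ∀ v ∈ S, T.neighborSet v ⊆ Sᶜ ∧ (T.neighborSet v).ncard = a)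
    (hII : ∀ v ∉ S, T.neighborSet v ⊆ S ∧ (T.neighborSet v).ncard = b)
    (v₀ : V) :
    PercGame.MakerWins T v₀ p q ↔
      (q : ℤ) ≤ (p : ℤ) * ((b : ℤ) - 2) - (((p + a - 1) / a : ℕ) : ℤ) * ((b : ℤ) - (a : ℤ)) := by
  obtain ⟨R⟩ := PercGame.Rooting.nonempty ha (ha.trans hab) hconn hacyc hI hII v₀
  refine ⟨fun hM => ?_, R.makerWins ha hab⟩
  by_contra! hlt
  obtain ⟨σ, hσ, hwin⟩ := hM
  obtain ⟨τ, hτ, hlose⟩ := R.breakerWins ha hab hp hlt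
  obtain ⟨n, hn⟩ := hlose σ hσ
  exact hwin τ hτ n hn
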